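/- With M = L ⊕ U (L = U^a ⊕ E₈(−1)^b, a ≥ 1) and the group Γ₃ generated by O⁺(L) ⊕ id_U, the Eichler transvections t_λ (λ ∈ L), and the reflections in norm −2 vectors δ with ⟨δ,e⟩ = 1: if δ = v + 0·f + k·e ∈ M satisfies ⟨δ,δ⟩ = −2 (equivalently ⟨v,v⟩ = −2), then there exists σ ∈ Γ₃ such that σ(δ) = μ + 0·f + 0·e for some μ ∈ L, i.e. σ(δ) lies in the sublattice L. -/

import Mathlib

noncomputable section

open scoped BigOperators

/-- Index type for the even unimodular lattice `L = U^a ⊕ E₈(-1)^b`. -/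
abbrev LIdx (a b : ℕ) := (Fin a × Fin 2) ⊕ (Fin b × Fin 8)

/-- Elements of the lattice `L = U^a ⊕ E₈(-1)^b`. -/
abbrev LVec (a b : ℕ) := LIdx a b → ℤ

/-- The Gram matrix of `U^a ⊕ E₈(-1)^b`. -/
def gramL (a b : ℕ) : LIdx a b → LIdx a b → ℤ := fun i j =>
  match i, j with
  | Sum.inl (k, s), Sum.inl (k', s') => if k = k' ∧ s ≠ s' then 1 else 0
  | Sum.inr (k, s), Sum.inr (k', s') => if k = k' then -(CartanMatrix.E₈ s s') else 0
  | _, _ => 0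

/-- The bilinear form of `L = U^a ⊕ E₈(-1)^b`. -/
def BL (a b : ℕ) (x y : LVec a b) : ℤ :=
  ∑ i, ∑ j, x i * gramL a b i j * y j

/-- Index type for `M = L ⊕ U`; the extra hyperbolic summand has basis `f = inr 0`,
`e = inr 1`.  An element `v + m f + n e` of `M` is the function sending `inl i` to `v i`,
`inr 0` to `m` and `inr 1` to `n`. -/
abbrev MIdx (a b : ℕ) := LIdx a b ⊕ Fin 2

/-- Elements of `M = L ⊕ U`. -/
abbrev MVec (a b : ℕ) := MIdx a b → ℤ

/-- The bilinear form of `M = L ⊕ U`: `⟨v + m f + n e, v' + m' f + n' e⟩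
  = ⟨v,v'⟩_L + m n' + n m'`. -/
def BM (a b : ℕ) (x y : MVec a b) : ℤ :=
  BL a b (fun i => x (Sum.inl i)) (fun i => y (Sum.inl i)) +
    x (Sum.inr 0) * y (Sum.inr 1) + x (Sum.inr 1) * y (Sum.inr 0)

/-- The basis vector `e` of the last hyperbolic summand of `M = L ⊕ U`. -/
def eM (a b : ℕ) : MVec a b := fun i => if i = Sum.inr 1 then 1 else 0

/-- The ℝ-bilinear extension of the form of `L = U^a ⊕ E₈(-1)^b` to `L ⊗ ℝ`. -/
def BLR (a b : ℕ) (x y : LIdx a b → ℝ) : ℝ :=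
  ∑ i, ∑ j, x i * (gramL a b i j : ℝ) * y j

/-- The ℝ-linear extension of a ℤ-linear automorphism of `ι → ℤ` to `ι → ℝ`. -/
def realExt {ι : Type} [Fintype ι] [DecidableEq ι] (φ : (ι → ℤ) ≃ₗ[ℤ] (ι → ℤ)) :
    (ι → ℝ) →ₗ[ℝ] (ι → ℝ) :=
  Matrix.toLin'
    ((LinearMap.toMatrix' (φ : (ι → ℤ) →ₗ[ℤ] (ι → ℤ))).map fun z : ℤ => (z : ℝ))

/-- `φ` preserves the orientation of maximal positive-definite subspaces of `L ⊗ ℝ`: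
for some `a`-dimensional subspace `P` of `L ⊗ ℝ` on which the form is positive definite,
the composite of the real extension of `φ` restricted to `P` with the orthogonal projection
back onto `P` has positive determinant. -/
def PresOrient (a b : ℕ) (φ : LVec a b ≃ₗ[ℤ] LVec a b) : Prop :=
  ∃ P : Submodule ℝ (LIdx a b → ℝ),
    Module.finrank ℝ P = a ∧
    (∀ v ∈ P, v ≠ 0 → 0 < BLR a b v v) ∧
    ∃ proj : (LIdx a b → ℝ) →ₗ[ℝ] P,
      (∀ p : P, proj (p : LIdx a b → ℝ) = p) ∧
      (∀ v : LIdx a b → ℝ, ∀ p ∈ P, BLR a b (v - (proj v : LIdx a b → ℝ)) p = 0) ∧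
      0 < LinearMap.det (proj ∘ₗ realExt φ ∘ₗ P.subtype)

/-- The automorphisms of `M = L ⊕ U` of the form `φ ⊕ id_U` with `φ ∈ O⁺(L)`. -/
def SOplus (a b : ℕ) : Set (MVec a b ≃ₗ[ℤ] MVec a b) :=
  {σ | (∀ x s, σ x (Sum.inr s) = x (Sum.inr s)) ∧
    ∃ φ : LVec a b ≃ₗ[ℤ] LVec a b,
      (∀ u w, BL a b (φ u) (φ w) = BL a b u w) ∧ PresOrient a b φ ∧
      ∀ x i, σ x (Sum.inl i) = φ (fun i' => x (Sum.inl i')) i}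

/-- The Eichler transvections `t_λ` of `M = L ⊕ U`, for `λ ∈ L`:
`t_λ(v + m f + n e) = (v + mλ) + m f + (n - ⟨v,λ⟩ - m⟨λ,λ⟩/2) e` (stated with the last
component doubled, since `⟨λ,λ⟩` is even). -/
def STransv (a b : ℕ) : Set (MVec a b ≃ₗ[ℤ] MVec a b) :=
  {σ | ∃ lam : LVec a b, ∀ x,
    (∀ i, σ x (Sum.inl i) = x (Sum.inl i) + x (Sum.inr 0) * lam i) ∧
    σ x (Sum.inr 0) = x (Sum.inr 0) ∧
    2 * σ x (Sum.inr 1) =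
      2 * x (Sum.inr 1) - 2 * BL a b (fun i => x (Sum.inl i)) lam -
        x (Sum.inr 0) * BL a b lam lam}

/-- The reflections `s_δ : x ↦ x + ⟨x,δ⟩δ` in the elements of
`R₁ = {δ : ⟨δ,δ⟩ = -2, ⟨δ,e⟩ = 1}`. -/
def SRefl (a b : ℕ) : Set (MVec a b ≃ₗ[ℤ] MVec a b) :=
  {σ | ∃ δ : MVec a b, BM a b δ δ = -2 ∧ BM a b δ (eM a b) = 1 ∧
    ∀ x, σ x = x + BM a b x δ • δ}

/-- The subgroup `Γ₃` of `O(M)` generated by `O⁺(L) ⊕ id_U`, the Eichler transvections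
`t_λ` for `λ ∈ L`, and the reflections in the norm `-2` vectors `δ` with `⟨δ,e⟩ = 1`. -/
def Gamma3 (a b : ℕ) : Subgroup (MVec a b ≃ₗ[ℤ] MVec a b) :=
  Subgroup.closure (SOplus a b ∪ STransv a b ∪ SRefl a b)

open Matrix Kronecker

section

variable {a b : ℕ}

lemma BL_eq_toBilin' (x y : LVec a b) : BL a b x y = Matrix.toBilin' (Matrix.of (gramL a b)) x y :=
  (Matrix.toBilin'_apply _ _ _).symm

lemma BL_add_left (x y z : LVec a b) : BL a b (x + y) z = BL a b x z + BL a b y z := by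
  simp [BL_eq_toBilin']

lemma BL_add_right (x y z : LVec a b) : BL a b x (y + z) = BL a b x y + BL a b x z := by
  simp [BL_eq_toBilin']

lemma BL_smul_left (c : ℤ) (x y : LVec a b) : BL a b (c • x) y = c * BL a b x y := by
  simp only [BL_eq_toBilin', map_smul, LinearMap.smul_apply, smul_eq_mul]

lemma BL_smul_right (c : ℤ) (x y : LVec a b) : BL a b x (c • y) = c * BL a b x y := by
  simp only [BL_eq_toBilin', map_smul, smul_eq_mul]

lemma gramL_comm (i j : LIdx a b) : gramL a b i j = gramL a b j i := by
  rcases i with ⟨k, s⟩ | ⟨k, s⟩ <;> rcases j with ⟨k', s'⟩ | ⟨k', s'⟩ <;>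
    simp only [gramL, eq_comm, ne_comm]
  rw [CartanMatrix.E₈_isSymm.apply]

lemma BL_comm (x y : LVec a b) : BL a b x y = BL a b y x := by
  unfold BL
  rw [Finset.sum_comm]
  refine Finset.sum_congr rfl fun i _ => Finset.sum_congr rfl fun j _ => ?_
  rw [gramL_comm]
  ring

/-- The lattice `L` is even. -/
lemma two_dvd_BL_self (x : LVec a b) : 2 ∣ BL a b x x := by
  have hx : x ∈ Submodule.span ℤ (Set.range (Pi.basisFun ℤ (LIdx a b))) := by
    simp [(Pi.basisFun ℤ (LIdx a b)).span_eq]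
  induction hx using Submodule.span_induction with
  | mem x h =>
    obtain ⟨i, rfl⟩ := h
    rw [BL_eq_toBilin', Pi.basisFun_apply, Matrix.toBilin'_single]
    rcases i with ⟨k, s⟩ | ⟨k, s⟩ <;> simp [gramL]
  | zero => simp [BL]
  | add x y _ _ hx hy =>
    have h : BL a b (x + y) (x + y) = BL a b x x + BL a b y y + 2 * BL a b x y := by
      rw [BL_add_left, BL_add_right, BL_add_right, BL_comm y x]
      ring
    rw [h]
    exact dvd_add (dvd_add hx hy) (dvd_mul_right _ _)
  | smul c x _ hx =>
    rw [BL_smul_left, BL_smul_right]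
    exact (hx.mul_left _).mul_left _

lemma gramL_eq_fromBlocks : Matrix.of (gramL a b) =
    fromBlocks ((1 : Matrix (Fin a) (Fin a) ℤ) ⊗ₖ !![0, 1; 1, 0]) 0 0
      ((1 : Matrix (Fin b) (Fin b) ℤ) ⊗ₖ (-CartanMatrix.E₈)) := by
  ext (⟨k, s⟩ | ⟨k, s⟩) (⟨k', s'⟩ | ⟨k', s'⟩)
  · by_cases h : k = k' <;> fin_cases s <;> fin_cases s' <;> simp [gramL, h]
  · simp [gramL]
  · simp [gramL]
  · by_cases h : k = k' <;> simp [gramL, h]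

/-- The lattice `L` is unimodular. -/
lemma isUnit_det_gramL : IsUnit (Matrix.of (gramL a b)).det := by
  rw [gramL_eq_fromBlocks, det_fromBlocks_zero₁₂, det_kronecker, det_kronecker]
  simp [Matrix.det_neg, CartanMatrix.E₈_det, isUnit_neg_one.pow a]

/-- A vector of norm `-2` is primitive, hence pairs with `L` onto `ℤ`. -/
lemma exists_BL_eq {v : LVec a b} (hv : BL a b v v = -2) (k : ℤ) :
    ∃ lam, BL a b v lam = k := by
  set w := v ᵥ* Matrix.of (gramL a b) with hw
  have hBL (y : LVec a b) : BL a b v y = ∑ i, w i * y i := by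
    rw [BL_eq_toBilin', Matrix.toBilin'_apply', dotProduct_mulVec]
    rfl
  obtain ⟨c, hc⟩ := Finset.gcd_eq_sum_mul Finset.univ w
  set g := Finset.univ.gcd w with hg
  have hdvd (i) : g ∣ v i := by
    have : v = w ᵥ* (Matrix.of (gramL a b))⁻¹ := by
      rw [hw, vecMul_vecMul, Matrix.mul_nonsing_inv _ isUnit_det_gramL, vecMul_one]
    rw [this]
    exact Finset.dvd_sum fun j hj => (Finset.gcd_dvd hj).mul_right _
  choose u hu using hdvd
  have hvu : v = g • u := funext fun i => by simp [hu i]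
  obtain ⟨q, hq⟩ := two_dvd_BL_self u
  have hgu : IsUnit g := by
    rw [hvu, BL_smul_left, BL_smul_right, hq] at hv
    exact IsUnit.of_mul_eq_one (-(g * q)) (by linarith)
  obtain ⟨d, hd⟩ := hgu.dvd (a := k)
  refine ⟨d • c, ?_⟩
  rw [BL_smul_right, hBL, hd, hc, mul_comm]

/-- The Eichler transvection `t_lam`, where `lam` has norm `2 * q`. -/
def eichlerEquiv (lam : LVec a b) (q : ℤ) (hq : BL a b lam lam = 2 * q) :
    MVec a b ≃ₗ[ℤ] MVec a b where
  toFun x := Sum.elim (fun i => x (Sum.inl i) + x (Sum.inr 0) * lam i)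
    ![x (Sum.inr 0), x (Sum.inr 1) - BL a b (fun i => x (Sum.inl i)) lam - x (Sum.inr 0) * q]
  invFun x := Sum.elim (fun i => x (Sum.inl i) - x (Sum.inr 0) * lam i)
    ![x (Sum.inr 0), x (Sum.inr 1) + BL a b (fun i => x (Sum.inl i)) lam - x (Sum.inr 0) * q]
  map_add' x y := by
    have h := BL_add_left (fun i => x (Sum.inl i)) (fun i => y (Sum.inl i)) lam
    ext (i | s)
    · simp only [Pi.add_apply, Sum.elim_inl]
      ring
    · fin_cases s
      · simp
      · simp only [Pi.add_def] at h
        simp [h]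
        ring
  map_smul' c x := by
    have h := BL_smul_left c (fun i => x (Sum.inl i)) lam
    ext (i | s)
    · simp [mul_add, mul_assoc]
    · fin_cases s
      · simp
      · simp only [Pi.smul_def, smul_eq_mul] at h
        simp [h]
        ring
  left_inv x := by
    have h := BL_add_left (fun i => x (Sum.inl i)) (x (Sum.inr 0) • lam) lam
    rw [BL_smul_left, hq] at h
    ext (i | s)
    · simp
    · fin_cases s
      · simp
      · simp only [Pi.add_def, Pi.smul_apply, smul_eq_mul] at h
        simp [h]
        ring
  right_inv x := by
    have h := BL_add_left (fun i => x (Sum.inl i)) ((-x (Sum.inr 0)) • lam) lam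
    rw [BL_smul_left, hq] at h
    ext (i | s)
    · simp
    · fin_cases s
      · simp
      · simp only [Pi.add_def, Pi.smul_apply, smul_eq_mul, neg_mul, ← sub_eq_add_neg] at h
        simp [h]
        ring

@[simp]
lemma eichlerEquiv_apply_e (lam : LVec a b) (q : ℤ) (hq : BL a b lam lam = 2 * q)
    (x : MVec a b) : eichlerEquiv lam q hq x (Sum.inr 1) =
      x (Sum.inr 1) - BL a b (fun i => x (Sum.inl i)) lam - x (Sum.inr 0) * q :=
  rfl

end

/-- If `δ = v + 0·f + k·e ∈ M` has `⟨δ,δ⟩ = -2`, then some `σ ∈ Γ₃` moves `δ` into the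
sublattice `L`, i.e. `σ(δ) = μ + 0·f + 0·e`. -/
theorem statement12 (a b : ℕ) (ha : 1 ≤ a) (δ : MVec a b)
    (hf : δ (Sum.inr 0) = 0) (hδ : BM a b δ δ = -2) :
    ∃ σ ∈ Gamma3 a b, σ δ (Sum.inr 0) = 0 ∧ σ δ (Sum.inr 1) = 0 := by
  have hv : BL a b (fun i => δ (Sum.inl i)) (fun i => δ (Sum.inl i)) = -2 := by
    simpa [BM, hf] using hδ
  obtain ⟨lam, hlam⟩ := exists_BL_eq hv (δ (Sum.inr 1))
  obtain ⟨q, hq⟩ := two_dvd_BL_self lam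
  refine ⟨eichlerEquiv lam q hq, Subgroup.subset_closure (.inl (.inr ?_)), ?_, ?_⟩
  · refine ⟨lam, fun x => ⟨fun i => rfl, rfl, ?_⟩⟩
    simp only [eichlerEquiv_apply_e, hq]
    ring
  · exact hf
  · simp [hlam, hf]
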